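/- Let f, g^{(1)},…,g^{(n)} : ℝ² → ℝ be smooth functions of (X,T) with f nowhere zero, satisfying the bilinear system: (i) f_{XT} g^{(i)} − f_X g^{(i)}_T − f_T g^{(i)}_X + f g^{(i)}_{XT} = f·g^{(i)} for each i = 1,…,n (i.e. D_X D_T f·g^{(i)} = f g^{(i)}); and (ii) f_{TT} f − (f_T)² = Σ_{1≤j<k≤n} c_{jk} g^{(j)} g^{(k)} (i.e. D_T² f·f = 2 Σ_{j<k} c_{jk} g^{(j)} g^{(k)}). Then u^{(i)} := g^{(i)}/f and ρ := 1 − (f·f_{XT} − f_X·f_T)/f² satisfy the multi-component coupled integrable dispersionless equations ∂_X∂_T u^{(i)} = u^{(i)}·(2ρ − 1) and ∂_T ρ + ∂_X( Σ_{1≤j<k≤n} c_{jk} u^{(j)} u^{(k)} ) = 0. -/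

import Mathlib

/-- Partial derivative with respect to the first variable. -/
noncomputable def pdx (f : ℝ → ℝ → ℝ) (x t : ℝ) : ℝ := deriv (fun y => f y t) x

/-- Partial derivative with respect to the second variable. -/
noncomputable def pdt (f : ℝ → ℝ → ℝ) (x t : ℝ) : ℝ := deriv (fun s => f x s) t

section PartialDerivatives

variable {h : ℝ → ℝ → ℝ}

lemma pdx_eq_fderiv (hh : Differentiable ℝ (fun p : ℝ × ℝ => h p.1 p.2)) (x t : ℝ) :
    pdx h x t = fderiv ℝ (fun p : ℝ × ℝ => h p.1 p.2) (x, t) (1, 0) := by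
  have hline : HasDerivAt (fun y : ℝ => (y, t)) ((1 : ℝ), (0 : ℝ)) x :=
    (hasDerivAt_id x).prodMk (hasDerivAt_const x t)
  exact ((hh (x, t)).hasFDerivAt.comp_hasDerivAt x hline).deriv

lemma pdt_eq_fderiv (hh : Differentiable ℝ (fun p : ℝ × ℝ => h p.1 p.2)) (x t : ℝ) :
    pdt h x t = fderiv ℝ (fun p : ℝ × ℝ => h p.1 p.2) (x, t) (0, 1) := by
  have hline : HasDerivAt (fun s : ℝ => (x, s)) ((0 : ℝ), (1 : ℝ)) t :=
    (hasDerivAt_const t x).prodMk (hasDerivAt_id t)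
  exact ((hh (x, t)).hasFDerivAt.comp_hasDerivAt t hline).deriv

lemma hasDerivAt_pdx (hh : Differentiable ℝ (fun p : ℝ × ℝ => h p.1 p.2)) (x t : ℝ) :
    HasDerivAt (fun y => h y t) (pdx h x t) x :=
  (hh.comp (differentiable_id.prodMk (differentiable_const t)) x).hasDerivAt

lemma hasDerivAt_pdt (hh : Differentiable ℝ (fun p : ℝ × ℝ => h p.1 p.2)) (x t : ℝ) :
    HasDerivAt (fun s => h x s) (pdt h x t) t :=
  (hh.comp ((differentiable_const x).prodMk differentiable_id) t).hasDerivAt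

lemma contDiff_pdx {m k : WithTop ℕ∞} (hh : ContDiff ℝ k (fun p : ℝ × ℝ => h p.1 p.2))
    (hmk : m + 1 ≤ k) : ContDiff ℝ m (fun p : ℝ × ℝ => pdx h p.1 p.2) := by
  have hd := (hh.of_le (le_add_self.trans hmk)).differentiable one_ne_zero
  simp only [pdx_eq_fderiv hd]
  exact (hh.fderiv_right hmk).clm_apply contDiff_const

lemma contDiff_pdt {m k : WithTop ℕ∞} (hh : ContDiff ℝ k (fun p : ℝ × ℝ => h p.1 p.2))
    (hmk : m + 1 ≤ k) : ContDiff ℝ m (fun p : ℝ × ℝ => pdt h p.1 p.2) := by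
  have hd := (hh.of_le (le_add_self.trans hmk)).differentiable one_ne_zero
  simp only [pdt_eq_fderiv hd]
  exact (hh.fderiv_right hmk).clm_apply contDiff_const

lemma pdt_pdx_comm (hh : ContDiff ℝ 2 (fun p : ℝ × ℝ => h p.1 p.2)) (x t : ℝ) :
    pdt (pdx h) x t = pdx (pdt h) x t := by
  have hd := hh.differentiable two_ne_zero
  have hle : (1 : WithTop ℕ∞) + 1 ≤ 2 := by norm_num
  have hd2 : Differentiable ℝ (fderiv ℝ (fun p : ℝ × ℝ => h p.1 p.2)) :=
    (hh.fderiv_right hle).differentiable one_ne_zero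
  rw [pdt_eq_fderiv ((contDiff_pdx hh hle).differentiable one_ne_zero),
    pdx_eq_fderiv ((contDiff_pdt hh hle).differentiable one_ne_zero)]
  simp only [pdx_eq_fderiv hd, pdt_eq_fderiv hd, Prod.mk.eta]
  have hsymm : IsSymmSndFDerivAt ℝ (fun p : ℝ × ℝ => h p.1 p.2) (x, t) :=
    hh.contDiffAt.isSymmSndFDerivAt (by simp)
  rw [fderiv_clm_apply (hd2 _) (differentiableAt_const _),
    fderiv_clm_apply (hd2 _) (differentiableAt_const _)]
  simpa using hsymm.eq (0, 1) (1, 0)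

end PartialDerivatives

/-- the bilinear equations D_X D_T f·g^{(i)} = f g^{(i)},
    D_T² f·f = 2 Σ_{j<k} c_{jk} g^{(j)} g^{(k)} yield, via the dependent variable
    transformation u^{(i)} = g^{(i)}/f, ρ = 1 − (log f)_{XT}, solutions of the
    multi-component coupled integrable dispersionless equations. -/
theorem mcmsp_bilinear_to_dispersionless (n : ℕ) (hn : 1 ≤ n)
    (c : Fin n → Fin n → ℝ)
    (f : ℝ → ℝ → ℝ) (g : Fin n → ℝ → ℝ → ℝ)
    (hf : ContDiff ℝ (⊤ : ℕ∞) (fun p : ℝ × ℝ => f p.1 p.2))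
    (hg : ∀ i, ContDiff ℝ (⊤ : ℕ∞) (fun p : ℝ × ℝ => g i p.1 p.2))
    (hfne : ∀ X T, f X T ≠ 0)
    (hbil1 : ∀ i X T,
      pdx (pdt f) X T * g i X T - pdx f X T * pdt (g i) X T
        - pdt f X T * pdx (g i) X T + f X T * pdx (pdt (g i)) X T
        = f X T * g i X T)
    (hbil2 : ∀ X T,
      pdt (pdt f) X T * f X T - (pdt f X T)^2
        = ∑ j : Fin n, ∑ k : Fin n,
            if j < k then c j k * g j X T * g k X T else 0)
    (u : Fin n → ℝ → ℝ → ℝ)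
    (hu : ∀ i X T, u i X T = g i X T / f X T)
    (ρ : ℝ → ℝ → ℝ)
    (hρ : ∀ X T, ρ X T = 1 - (f X T * pdx (pdt f) X T - pdx f X T * pdt f X T) / (f X T)^2) :
    (∀ i X T, pdx (pdt (u i)) X T = u i X T * (2 * ρ X T - 1)) ∧
    (∀ X T,
      pdt ρ X T
        + pdx (fun X' T' => ∑ j : Fin n, ∑ k : Fin n,
            if j < k then c j k * u j X' T' * u k X' T' else 0) X T = 0) := by
  have hle : ((⊤ : ℕ∞) : WithTop ℕ∞) + 1 ≤ ((⊤ : ℕ∞) : WithTop ℕ∞) := by simp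
  have hne : ((⊤ : ℕ∞) : WithTop ℕ∞) ≠ 0 := by simp
  have h2 : (2 : WithTop ℕ∞) ≤ ((⊤ : ℕ∞) : WithTop ℕ∞) := WithTop.coe_le_coe.2 le_top
  have hfT := contDiff_pdt hf hle
  have df := hf.differentiable hne
  have dfT := hfT.differentiable hne
  have dfX := (contDiff_pdx hf hle).differentiable hne
  have dfTT := (contDiff_pdt hfT hle).differentiable hne
  have dfXT := (contDiff_pdx hfT hle).differentiable hne
  constructor
  · intro i X T
    have dg := (hg i).differentiable hne
    have dgT := (contDiff_pdt (hg i) hle).differentiable hne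
    have huT : pdt (u i) = fun x t =>
        (pdt (g i) x t * f x t - g i x t * pdt f x t) / f x t ^ 2 := by
      funext x t
      have hu' : u i x = fun s => g i x s / f x s := funext (hu i x)
      exact (show pdt (u i) x t = deriv (u i x) t from rfl).trans
        (hu' ▸ ((hasDerivAt_pdt dg x t).div (hasDerivAt_pdt df x t) (hfne x t)).deriv)
    have hd := ((((hasDerivAt_pdx dgT X T).mul (hasDerivAt_pdx df X T)).sub
      ((hasDerivAt_pdx dg X T).mul (hasDerivAt_pdx dfT X T))).div
      ((hasDerivAt_pdx df X T).pow 2) (pow_ne_zero 2 (hfne X T))).deriv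
    rw [huT]
    refine Eq.trans hd ?_
    have hf0 := hfne X T
    have hb := hbil1 i X T
    rw [hu, hρ]
    simp only [Pi.mul_apply, Pi.sub_apply, Pi.pow_apply]
    field_simp
    linear_combination f X T ^ 2 * hb
  · intro X T
    have hsum : (fun X' T' => ∑ j : Fin n, ∑ k : Fin n,
        if j < k then c j k * u j X' T' * u k X' T' else 0) = fun x t =>
        (pdt (pdt f) x t * f x t - pdt f x t ^ 2) / f x t ^ 2 := by
      funext x t
      rw [hbil2, Finset.sum_div]
      refine Finset.sum_congr rfl fun j _ => ?_
      rw [Finset.sum_div]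
      refine Finset.sum_congr rfl fun k _ => ?_
      have hf0 := hfne x t
      split_ifs
      · rw [hu, hu]
        field_simp
      · simp
    have hρ' : ρ = fun x t =>
        1 - (f x t * pdx (pdt f) x t - pdx f x t * pdt f x t) / f x t ^ 2 := by
      funext x t
      exact hρ x t
    have hdX := ((((hasDerivAt_pdx dfTT X T).mul (hasDerivAt_pdx df X T)).sub
      ((hasDerivAt_pdx dfT X T).pow 2)).div
      ((hasDerivAt_pdx df X T).pow 2) (pow_ne_zero 2 (hfne X T))).deriv
    have hdT := (((((hasDerivAt_pdt df X T).mul (hasDerivAt_pdt dfXT X T)).sub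
      ((hasDerivAt_pdt dfX X T).mul (hasDerivAt_pdt dfT X T))).div
      ((hasDerivAt_pdt df X T).pow 2) (pow_ne_zero 2 (hfne X T))).const_sub 1).deriv
    rw [hsum, hρ']
    refine (congrArg₂ (· + ·) hdT hdX).trans ?_
    have hf0 := hfne X T
    simp only [Pi.mul_apply, Pi.sub_apply, Pi.pow_apply]
    rw [pdt_pdx_comm (hf.of_le h2), pdt_pdx_comm (hfT.of_le h2)]
    field_simp
    ring
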